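/- Let S = [0,1]² and let b(x,y) = x(1 − x)·y(1 − y) be its bubble function. There exists a constant c > 0 such that for every integer p ≥ 1 and every real polynomial q in two variables of degree at most p in each variable, ∫_S ((∂_x(b·q))² + (∂_y(b·q))²) dx dy ≤ c · p² · ∫_S q² dx dy. -/

import Mathlib

open MeasureTheory

/-- The unit square `S = [0,1]²`. -/
def unitSquare : Set (ℝ × ℝ) := Set.Icc (0 : ℝ) 1 ×ˢ Set.Icc (0 : ℝ) 1

/-- The bubble function `b(x,y) = x(1-x)·y(1-y)` of the unit square, as a
polynomial. -/
noncomputable def squareBubble : MvPolynomial (Fin 2) ℝ :=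
  MvPolynomial.X 0 * (1 - MvPolynomial.X 0) * (MvPolynomial.X 1 * (1 - MvPolynomial.X 1))

open Polynomial in
/-- Integral over the unit interval of a univariate polynomial. -/
noncomputable def intI (f : ℝ[X]) : ℝ := ∫ x in (0:ℝ)..1, f.eval x

section OneD
open Polynomial

lemma intI_ii (f : ℝ[X]) : IntervalIntegrable (fun x => f.eval x) volume 0 1 :=
  f.continuous.intervalIntegrable 0 1

lemma intI_add (f g : ℝ[X]) : intI (f + g) = intI f + intI g := by
  simp only [intI, eval_add]
  exact intervalIntegral.integral_add (intI_ii f) (intI_ii g)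

lemma intI_C_mul (a : ℝ) (f : ℝ[X]) : intI (C a * f) = a * intI f := by
  simp only [intI, eval_mul, eval_C]
  exact intervalIntegral.integral_const_mul a _

lemma intI_neg (f : ℝ[X]) : intI (-f) = - intI f := by
  have := intI_C_mul (-1) f
  simpa using this

lemma intI_sub (f g : ℝ[X]) : intI (f - g) = intI f - intI g := by
  rw [sub_eq_add_neg, intI_add, intI_neg]; ring

lemma intI_mono {f g : ℝ[X]} (h : ∀ x ∈ Set.Icc (0:ℝ) 1, f.eval x ≤ g.eval x) :
    intI f ≤ intI g :=
  intervalIntegral.integral_mono_on zero_le_one (intI_ii f) (intI_ii g) h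

lemma intI_nonneg {f : ℝ[X]} (h : ∀ x ∈ Set.Icc (0:ℝ) 1, 0 ≤ f.eval x) : 0 ≤ intI f :=
  intervalIntegral.integral_nonneg zero_le_one h

lemma intI_sq_nonneg (f : ℝ[X]) : 0 ≤ intI (f * f) :=
  intI_nonneg fun x _ => by rw [eval_mul]; exact mul_self_nonneg _

lemma intI_sq_pos {f : ℝ[X]} (hf : f ≠ 0) : 0 < intI (f * f) := by
  have hex : ∃ c ∈ Set.Icc (0:ℝ) 1, f.eval c ≠ 0 := by
    by_contra! h
    apply hf
    apply Polynomial.eq_zero_of_infinite_isRoot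
    exact (Set.Icc_infinite (zero_lt_one (α := ℝ))).mono fun x hx => h x hx
  obtain ⟨c, hc, hc0⟩ := hex
  refine intervalIntegral.integral_pos zero_lt_one (f * f).continuous.continuousOn ?_ ⟨c, hc, ?_⟩
  · intro x _; rw [eval_mul]; exact mul_self_nonneg _
  · rw [eval_mul]; exact mul_self_pos.2 hc0

lemma intI_derivative (f : ℝ[X]) : intI (derivative f) = f.eval 1 - f.eval 0 := by
  apply intervalIntegral.integral_eq_sub_of_hasDerivAt (f := fun x => f.eval x)
  · intro x _; exact f.hasDerivAt x
  · exact intI_ii _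

/-- The Legendre operator. -/
noncomputable def legOp (f : ℝ[X]) : ℝ[X] := - derivative (X * (1 - X) * derivative f)

lemma intI_legOp (f g : ℝ[X]) :
    intI (legOp f * g) = intI (X * (1 - X) * (derivative f * derivative g)) := by
  have h := intI_derivative (X * (1 - X) * derivative f * g)
  rw [derivative_mul, intI_add] at h
  simp at h
  have e : X * (1 - X) * (derivative f * derivative g)
    = X * (1 - X) * derivative f * derivative g := by ring
  rw [legOp, neg_mul, intI_neg, e]
  simp only [derivative_mul]
  simp
  linarith

lemma intI_legOp_symm (f g : ℝ[X]) : intI (legOp f * g) = intI (legOp g * f) := by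
  rw [intI_legOp, intI_legOp, mul_comm (derivative f)]

lemma coeff_legOp (f : ℝ[X]) (k : ℕ) :
    (legOp f).coeff k = (k + 1) * (k * f.coeff k - (k + 1) * f.coeff (k + 1)) := by
  have e : X * (1 - X) * derivative f = X * derivative f - X * (X * derivative f) := by ring
  rw [legOp, coeff_neg, coeff_derivative, e, coeff_sub, coeff_X_mul, coeff_X_mul]
  rcases k with _ | k
  · simp [coeff_derivative]
  · rw [coeff_X_mul, coeff_derivative, coeff_derivative]; push_cast; ring

lemma legOp_add (f g : ℝ[X]) : legOp (f + g) = legOp f + legOp g := by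
  simp only [legOp, derivative_add, mul_add]; ring

lemma legOp_C_mul (a : ℝ) (f : ℝ[X]) : legOp (C a * f) = C a * legOp f := by
  ext k; simp only [coeff_legOp, coeff_C_mul]; ring

/-- degree less than `n`, coefficientwise -/
def degLow (n : ℕ) (f : ℝ[X]) : Prop := ∀ k, n ≤ k → f.coeff k = 0

lemma degLow_legOp {n : ℕ} {f : ℝ[X]} (hf : degLow n f) : degLow n (legOp f) := by
  intro k hk
  rw [coeff_legOp, hf k hk, hf (k+1) (by omega)]; ring

lemma exists_proj (n : ℕ) : ∀ f : ℝ[X], ∃ s, degLow n s ∧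
    ∀ g, degLow n g → intI ((f - s) * g) = 0 := by
  induction n with
  | zero =>
    intro f
    refine ⟨0, fun k _ => by simp, fun g hg => ?_⟩
    have : g = 0 := by ext k; simpa using hg k (Nat.zero_le _)
    simp [this, intI]
  | succ n ih =>
    intro f
    obtain ⟨s, hs, hs'⟩ := ih (X ^ n)
    obtain ⟨t, ht, ht'⟩ := ih f
    set l := X ^ n - s with hl
    have hln : l.coeff n = 1 := by simp [hl, hs n le_rfl]
    have hl0 : l ≠ 0 := by rintro h; simp [h] at hln
    have hlk : degLow (n+1) l := by
      intro k hk
      rw [hl, coeff_sub, hs k (by omega), coeff_X_pow, if_neg (by omega)]; ring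
    have hpos := intI_sq_pos hl0
    refine ⟨t + C (intI (f * l) / intI (l * l)) * l, ?_, ?_⟩
    · intro k hk
      rw [coeff_add, coeff_C_mul, hlk k hk, ht k (by omega)]; ring
    · intro g hg
      set c := intI (f * l) / intI (l * l) with hc
      set g' := g - C (g.coeff n) * l with hg'
      have hg'd : degLow n g' := by
        intro k hk
        rw [hg', coeff_sub, coeff_C_mul]
        rcases eq_or_lt_of_le hk with rfl | h
        · rw [hln]; ring
        · rw [hg k h, hlk k h]; ring
      have e : (f - (t + C c * l)) * g = ((f - t) * g' - C c * (l * g'))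
          + C (g.coeff n) * (f * l - l * t - C c * (l * l)) := by
        have : g = g' + C (g.coeff n) * l := by rw [hg']; ring
        generalize g.coeff n = a at *
        rw [this]; ring
      rw [e, intI_add, intI_sub, intI_C_mul, intI_C_mul, intI_sub, intI_sub, intI_C_mul,
        ht' g' hg'd, hs' g' hg'd, hs' t ht, hc]
      field_simp
      ring

lemma legendre_ineq (n : ℕ) : ∀ q : ℝ[X], degLow (n+1) q →
    intI (legOp q * q) ≤ n * (n + 1) * intI (q * q) := by
  induction n with
  | zero =>
    intro q hq
    have : legOp q = 0 := by
      ext k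
      rw [coeff_legOp, hq (k+1) (by omega)]
      rcases k with _ | k
      · simp
      · rw [hq _ (by omega)]; simp
    simp [this, intI]
  | succ n ih =>
    intro q hq
    obtain ⟨s, hs, hs'⟩ := exists_proj (n+1) (X ^ (n+1))
    set l := X ^ (n+1) - s with hl
    have hln : l.coeff (n+1) = 1 := by simp [hl, hs (n+1) le_rfl]
    have hlk : degLow (n+1+1) l := by
      intro k hk
      rw [hl, coeff_sub, hs k (by omega), coeff_X_pow, if_neg (by omega)]; ring
    set a := q.coeff (n+1) with ha
    set t := q - C a * l with ht
    have htd : degLow (n+1) t := by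
      intro k hk
      rw [ht, coeff_sub, coeff_C_mul]
      rcases eq_or_lt_of_le hk with rfl | h
      · rw [hln]; ring
      · rw [hq k h, hlk k h]; ring
    have hqe : q = t + C a * l := by rw [ht]; ring
    have h1 : intI (l * t) = 0 := hs' t htd
    have h2 : intI (l * legOp t) = 0 := hs' _ (degLow_legOp htd)
    have h2' : intI (legOp l * t) = 0 := by
      rw [intI_legOp_symm, mul_comm]; exact h2
    set r := legOp l - C (((n:ℝ)+1) * (n+2)) * l with hr
    have hrd : degLow (n+1) r := by
      intro k hk
      rw [hr, coeff_sub, coeff_C_mul, coeff_legOp]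
      rcases eq_or_lt_of_le hk with rfl | h
      · rw [hln, hlk (n+1+1) le_rfl]; push_cast; ring
      · rw [hlk k h, hlk (k+1) (by omega)]; ring
    have h3 : intI (legOp l * l) = ((n:ℝ)+1) * (n+2) * intI (l * l) := by
      have : legOp l * l = l * r + C (((n:ℝ)+1) * (n+2)) * (l * l) := by rw [hr]; ring
      rw [this, intI_add, intI_C_mul, hs' r hrd]; ring
    have h4 := ih t htd
    have e1 : intI (q * q) = intI (t * t) + a ^ 2 * intI (l * l) := by
      have : q * q = t * t + C (2 * a) * (l * t) + C (a^2) * (l * l) := by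
        rw [hqe, C_mul, C_pow]
        have : (C 2 : ℝ[X]) = 2 := rfl
        rw [this]; ring
      rw [this, intI_add, intI_add, intI_C_mul, intI_C_mul, h1]; ring
    have e2 : intI (legOp q * q) = intI (legOp t * t) + a ^ 2 * intI (legOp l * l) := by
      have : legOp q * q = legOp t * t + C a * (l * legOp t) + C a * (legOp l * t)
          + C (a^2) * (legOp l * l) := by
        rw [hqe, legOp_add, legOp_C_mul, C_pow]; ring
      rw [this, intI_add, intI_add, intI_add, intI_C_mul, intI_C_mul, intI_C_mul, h2, h2']; ring
    rw [e1, e2, h3]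
    have := intI_sq_nonneg t
    push_cast
    nlinarith [mul_nonneg (Nat.cast_nonneg (α := ℝ) n) this]

lemma oneD (p : ℕ) (hp : 1 ≤ p) (q : ℝ[X]) (hq : q.natDegree ≤ p) :
    intI (derivative (X * (1 - X) * q) * derivative (X * (1 - X) * q)) ≤
      3 * (p:ℝ)^2 * intI (q * q) := by
  have h1 : intI (X * (1 - X) * (derivative q * derivative q))
      ≤ p * (p + 1) * intI (q * q) := by
    rw [← intI_legOp]
    exact legendre_ineq p q fun k hk => coeff_eq_zero_of_natDegree_lt (by omega)
  have h2 : intI (derivative (X * (1 - X) * q) * derivative (X * (1 - X) * q)) ≤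
      intI (C 2 * (q * q) + C (1/2) * (X * (1 - X) * (derivative q * derivative q))) := by
    apply intI_mono
    rintro x ⟨hx0, hx1⟩
    simp only [derivative_mul, derivative_X, derivative_sub, derivative_one, eval_mul, eval_add,
      eval_sub, eval_X, eval_one, eval_C, eval_zero]
    generalize eval x q = a
    generalize eval x (derivative q) = d
    have hw0 : 0 ≤ x * (1 - x) := mul_nonneg hx0 (by linarith)
    have hw1 : x * (1 - x) ≤ 1/4 := by nlinarith [sq_nonneg (x - 1/2)]
    have k1 : (1 - 2*x)^2 * a^2 ≤ a^2 := by
      have : (1-2*x)^2 ≤ 1 := by nlinarith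
      nlinarith [sq_nonneg a]
    have k2 : (x*(1-x))^2 * d^2 ≤ 1/4 * (x * (1-x)) * d^2 := by
      apply mul_le_mul_of_nonneg_right _ (sq_nonneg d)
      nlinarith
    nlinarith [sq_nonneg ((1-2*x)*a - x*(1-x)*d)]
  rw [intI_add, intI_C_mul, intI_C_mul] at h2
  have hp' : (1:ℝ) ≤ p := by exact_mod_cast hp
  have h0 := intI_sq_nonneg q
  have : 2 * intI (q*q) + 1/2 * (p * (p + 1) * intI (q * q)) ≤ 3 * (p:ℝ)^2 * intI (q * q) := by
    have : 2 + 1/2 * (p * (p+1)) ≤ 3 * (p:ℝ)^2 := by nlinarith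
    nlinarith
  linarith

/-- Restriction of a bivariate polynomial to a line parallel to axis `i`. -/
noncomputable def slice (i : Fin 2) (y : ℝ) : MvPolynomial (Fin 2) ℝ →ₐ[ℝ] ℝ[X] :=
  MvPolynomial.aeval (fun j => if j = i then X else C y)

lemma slice_X (i j : Fin 2) (y : ℝ) :
    slice i y (MvPolynomial.X j) = if j = i then X else C y := by simp [slice]

lemma eval_slice (i : Fin 2) (x y : ℝ) (q : MvPolynomial (Fin 2) ℝ) :
    (slice i y q).eval x = MvPolynomial.eval (fun j => if j = i then x else y) q := by
  induction q using MvPolynomial.induction_on with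
  | C a => simp [slice]
  | add f g hf hg => simp [hf, hg]
  | mul_X f j hf => rw [map_mul, map_mul, eval_mul, hf, slice_X]; split_ifs <;> simp_all

lemma derivative_slice (i : Fin 2) (y : ℝ) (q : MvPolynomial (Fin 2) ℝ) :
    derivative (slice i y q) = slice i y (MvPolynomial.pderiv i q) := by
  induction q using MvPolynomial.induction_on with
  | C a => simp [slice]
  | add f g hf hg => simp [hf, hg]
  | mul_X f j hf =>
    rw [map_mul, derivative_mul, hf, Derivation.leibniz, map_add, smul_eq_mul, smul_eq_mul,
      map_mul, map_mul, slice_X, MvPolynomial.pderiv_X]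
    by_cases h : j = i
    · subst h; simp; ring
    · simp [h, mul_comm]

lemma natDegree_slice (i : Fin 2) (y : ℝ) (q : MvPolynomial (Fin 2) ℝ) :
    (slice i y q).natDegree ≤ q.degreeOf i := by
  rw [slice, MvPolynomial.aeval_def, MvPolynomial.eval₂_eq]
  apply natDegree_sum_le_of_forall_le
  intro d hd
  have hdi : d i ≤ q.degreeOf i := MvPolynomial.monomial_le_degreeOf i hd
  refine le_trans (natDegree_C_mul_le _ _) (le_trans (natDegree_prod_le _ _) ?_)
  refine le_trans (Finset.sum_le_sum (g := fun j => if j = i then d i else 0) ?_) ?_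
  · intro j _
    by_cases h : j = i
    · subst h; simp
    · simp only [if_neg h, ← C_pow, natDegree_C, le_refl]
  · rw [Finset.sum_ite_eq']; split_ifs <;> omega

lemma slice_est (i : Fin 2) (y : ℝ) (hy : y ∈ Set.Icc (0:ℝ) 1) (p : ℕ) (hp : 1 ≤ p)
    (q : MvPolynomial (Fin 2) ℝ) (hq : q.degreeOf i ≤ p) :
    ∫ x in (0:ℝ)..1, (MvPolynomial.eval (fun j => if j = i then x else y)
        (MvPolynomial.pderiv i (squareBubble * q))) ^ 2 ≤
      3 * (p:ℝ)^2 * ∫ x in (0:ℝ)..1, (MvPolynomial.eval (fun j => if j = i then x else y) q) ^ 2 := by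
  have hb : slice i y (squareBubble * q) = C (y * (1 - y)) * (X * (1 - X) * slice i y q) := by
    fin_cases i <;> simp [squareBubble, slice_X] <;> ring
  have h := oneD p hp (slice i y q) ((natDegree_slice i y q).trans hq)
  simp only [← eval_slice, ← derivative_slice, hb]
  have e : ∀ f : ℝ[X], ∫ x in (0:ℝ)..1, (f.eval x)^2 = intI (f * f) := by
    intro f; simp [intI, sq]
  rw [e, e, derivative_C_mul]
  set D := derivative (X * (1 - X) * slice i y q)
  have : C (y * (1 - y)) * D * (C (y * (1 - y)) * D) = C ((y * (1-y))^2) * (D * D) := by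
    rw [C_pow]; ring
  rw [this, intI_C_mul]
  have hw0 : 0 ≤ y * (1 - y) := mul_nonneg hy.1 (by linarith [hy.2])
  have hw1 : y * (1 - y) ≤ 1 := by nlinarith [sq_nonneg (y - 1/2)]
  have hD := intI_sq_nonneg D
  have : (y * (1-y))^2 ≤ 1 := by nlinarith
  nlinarith

end OneD

lemma cont_eval (q : MvPolynomial (Fin 2) ℝ) :
    Continuous fun z : ℝ × ℝ => MvPolynomial.eval ![z.1, z.2] q := by
  refine (MvPolynomial.continuous_eval q).comp (continuous_pi fun i => ?_)
  fin_cases i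
  · exact continuous_fst
  · exact continuous_snd

lemma intOn (f : ℝ × ℝ → ℝ) (hf : Continuous f) : IntegrableOn f unitSquare :=
  hf.continuousOn.integrableOn_compact (isCompact_Icc.prod isCompact_Icc)

lemma fubini_xy (f : ℝ × ℝ → ℝ) (hf : Continuous f) :
    ∫ z in unitSquare, f z = ∫ x in (0:ℝ)..1, ∫ y in (0:ℝ)..1, f (x, y) := by
  have := intOn f hf
  rw [unitSquare, Measure.volume_eq_prod] at *
  rw [setIntegral_prod f this]
  simp only [intervalIntegral.integral_of_le zero_le_one, integral_Icc_eq_integral_Ioc]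

lemma fubini_yx (f : ℝ × ℝ → ℝ) (hf : Continuous f) :
    ∫ z in unitSquare, f z = ∫ y in (0:ℝ)..1, ∫ x in (0:ℝ)..1, f (x, y) := by
  rw [fubini_xy f hf]
  apply MeasureTheory.intervalIntegral_intervalIntegral_swap
  have := intOn f hf
  rw [unitSquare, Measure.volume_eq_prod] at this
  rw [Set.uIoc_of_le zero_le_one]
  exact (this.mono_set (Set.prod_mono Set.Ioc_subset_Icc_self Set.Ioc_subset_Icc_self))


lemma vec0 (x y : ℝ) : (fun j : Fin 2 => if j = 0 then x else y) = ![x, y] := by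
  ext j; fin_cases j <;> simp

lemma vec1 (x y : ℝ) : (fun j : Fin 2 => if j = 1 then y else x) = ![x, y] := by
  ext j; fin_cases j <;> simp

lemma cont_eval_sq (q : MvPolynomial (Fin 2) ℝ) :
    Continuous fun z : ℝ × ℝ => (MvPolynomial.eval ![z.1, z.2] q) ^ 2 := (cont_eval q).pow 2

lemma square_le_yx (A Q : ℝ × ℝ → ℝ) (hA : Continuous A) (hQ : Continuous Q) (k : ℝ)
    (h : ∀ y ∈ Set.Icc (0:ℝ) 1, ∫ x in (0:ℝ)..1, A (x, y) ≤ k * ∫ x in (0:ℝ)..1, Q (x, y)) :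
    ∫ z in unitSquare, A z ≤ k * ∫ z in unitSquare, Q z := by
  have hkQ : Continuous fun z => k * Q z := by fun_prop
  rw [← integral_const_mul, ← sub_nonneg, ← integral_sub (intOn _ hkQ) (intOn _ hA),
    fubini_yx _ (by fun_prop)]
  refine intervalIntegral.integral_nonneg zero_le_one fun y hy => ?_
  have i1 : Continuous fun x : ℝ => k * Q (x, y) := by fun_prop
  have i2 : Continuous fun x : ℝ => A (x, y) := by fun_prop
  rw [intervalIntegral.integral_sub (i1.intervalIntegrable 0 1) (i2.intervalIntegrable 0 1),
    intervalIntegral.integral_const_mul, sub_nonneg]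
  exact h y hy

lemma square_le_xy (A Q : ℝ × ℝ → ℝ) (hA : Continuous A) (hQ : Continuous Q) (k : ℝ)
    (h : ∀ x ∈ Set.Icc (0:ℝ) 1, ∫ y in (0:ℝ)..1, A (x, y) ≤ k * ∫ y in (0:ℝ)..1, Q (x, y)) :
    ∫ z in unitSquare, A z ≤ k * ∫ z in unitSquare, Q z := by
  have hkQ : Continuous fun z => k * Q z := by fun_prop
  rw [← integral_const_mul, ← sub_nonneg, ← integral_sub (intOn _ hkQ) (intOn _ hA),
    fubini_xy _ (by fun_prop)]
  refine intervalIntegral.integral_nonneg zero_le_one fun x hx => ?_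
  have i1 : Continuous fun y : ℝ => k * Q (x, y) := by fun_prop
  have i2 : Continuous fun y : ℝ => A (x, y) := by fun_prop
  rw [intervalIntegral.integral_sub (i1.intervalIntegrable 0 1) (i2.intervalIntegrable 0 1),
    intervalIntegral.integral_const_mul, sub_nonneg]
  exact h x hx

/-- $hp$-explicit polynomial weighted H¹-to-L² inverse estimate
on the unit square (Proposition 3.7 of the paper, squared form). -/
theorem weighted_h1_inverse_estimate_square :
    ∃ c : ℝ, 0 < c ∧
      ∀ p : ℕ, 1 ≤ p → ∀ q : MvPolynomial (Fin 2) ℝ,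
        (∀ i : Fin 2, q.degreeOf i ≤ p) →
        ∫ z in unitSquare,
            ((MvPolynomial.eval ![z.1, z.2] (MvPolynomial.pderiv 0 (squareBubble * q))) ^ 2 +
              (MvPolynomial.eval ![z.1, z.2] (MvPolynomial.pderiv 1 (squareBubble * q))) ^ 2) ≤
          c * (p : ℝ) ^ 2 *
            ∫ z in unitSquare, (MvPolynomial.eval ![z.1, z.2] q) ^ 2 := by
  refine ⟨6, by norm_num, fun p hp q hq => ?_⟩
  have c0 := cont_eval_sq (MvPolynomial.pderiv 0 (squareBubble * q))
  have c1 := cont_eval_sq (MvPolynomial.pderiv 1 (squareBubble * q))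
  have cq := cont_eval_sq q
  rw [integral_add (intOn _ c0) (intOn _ c1)]
  have h0 := square_le_yx _ _ c0 cq (3 * (p : ℝ) ^ 2) fun y hy => by
    simpa only [vec0] using slice_est 0 y hy p hp q (hq 0)
  have h1 := square_le_xy _ _ c1 cq (3 * (p : ℝ) ^ 2) fun x hx => by
    simpa only [vec1] using slice_est 1 x hx p hp q (hq 1)
  linarith
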